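/- Let α > 0, c₀, γ ∈ ℝ, λ = −γ/α², k = (c₀ + γ/α²)/2, and T ∈ (0, ∞]. Let u : [0,T) × ℝ → ℝ be twice continuously differentiable such that for every t ∈ [0,T): u(t,·) and ∂ₓu(t,·) are square-integrable on ℝ and u(t,y) → 0 as |y| → ∞, and such that u satisfies pointwise ∂ₜu + (u + λ)∂ₓu = −∂ₓ[p ∗ ((α²/2)(∂ₓu)² + u² + 2ku)] (convolution in the space variable). Let q : [0,T) × ℝ → ℝ be continuously differentiable with q(0,x) = x and ∂ₜq(t,x) = u(t,q(t,x)) + λ. Then for every fixed x ∈ ℝ: the function t ↦ A(t,x) = e^{q(t,x)/α + (k−λ)t/α} ((1/α)(u(t,q(t,x)) + k) − ∂ₓu(t,q(t,x))) is monotonically nondecreasing on [0,T), and the function t ↦ B(t,x) = e^{−q(t,x)/α + (λ−k)t/α} ((1/α)(u(t,q(t,x)) + k) + ∂ₓu(t,q(t,x))) is monotonically nonincreasing on [0,T). -/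

import Mathlib

open MeasureTheory Filter

/-- A continuous function dominated by an integrable function plus a constant becomes integrable
on left half-lines once multiplied by an increasing exponential. -/
theorem integrableOn_exp_div_mul_Iic {α : ℝ} (hα : 0 < α) {w P : ℝ → ℝ} {C : ℝ}
    (hw : Continuous w) (hP : Integrable P) (hwP : ∀ y, |w y| ≤ P y + C) (x : ℝ) :
    IntegrableOn (fun y => Real.exp (y / α) * w y) (Set.Iic x) := by
  have hexp : IntegrableOn (fun y : ℝ => Real.exp (y / α)) (Set.Iic x) := by
    simpa [div_eq_inv_mul] using integrableOn_exp_mul_Iic (inv_pos.2 hα) x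
  have hbdd : IntegrableOn (fun y => Real.exp (y / α) * P y) (Set.Iic x) := by
    refine Integrable.bdd_mul (c := Real.exp (x / α)) hP.integrableOn
      (by fun_prop) ?_
    filter_upwards [ae_restrict_mem measurableSet_Iic] with y hy
    rw [Real.norm_eq_abs, Real.abs_exp]
    exact Real.exp_le_exp.2 (div_le_div_of_nonneg_right hy hα.le)
  refine Integrable.mono' (hbdd.add (hexp.mul_const C)) (by fun_prop) (ae_of_all _ fun y => ?_)
  rw [Real.norm_eq_abs, abs_mul, Real.abs_exp, Pi.add_apply, ← mul_add]
  exact mul_le_mul_of_nonneg_left (hwP y) (Real.exp_pos _).le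

/-- The mirror image of `integrableOn_exp_div_mul_Iic`. -/
theorem integrableOn_exp_neg_div_mul_Ioi {α : ℝ} (hα : 0 < α) {w P : ℝ → ℝ} {C : ℝ}
    (hw : Continuous w) (hP : Integrable P) (hwP : ∀ y, |w y| ≤ P y + C) (x : ℝ) :
    IntegrableOn (fun y => Real.exp (-y / α) * w y) (Set.Ioi x) := by
  have h := integrableOn_exp_div_mul_Iic hα (w := fun y => w (-y)) (hw.comp continuous_neg)
    hP.comp_neg (fun y => hwP (-y)) (-x)
  simpa using (h.mono_set Set.Iio_subset_Iic_self).comp_neg_Ioi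

theorem hasDerivAt_integral_Iic {φ : ℝ → ℝ} (hφ : Continuous φ)
    (hint : ∀ x, IntegrableOn φ (Set.Iic x)) (x : ℝ) :
    HasDerivAt (fun z => ∫ y in Set.Iic z, φ y) (φ x) x := by
  have h : (fun z => ∫ y in Set.Iic z, φ y)
      = fun z => (∫ y in Set.Iic x, φ y) + ∫ y in x..z, φ y := by
    ext z
    rw [← intervalIntegral.integral_Iic_sub_Iic (hint x) (hint z)]
    ring
  rw [h]
  exact (intervalIntegral.integral_hasDerivAt_right (by simp)
    (hφ.stronglyMeasurableAtFilter _ _) hφ.continuousAt).const_add _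

theorem hasDerivAt_integral_Ioi {φ : ℝ → ℝ} (hφ : Continuous φ)
    (hint : ∀ x, IntegrableOn φ (Set.Ioi x)) (x : ℝ) :
    HasDerivAt (fun z => ∫ y in Set.Ioi z, φ y) (-φ x) x := by
  have hint' : ∀ x, IntegrableOn (fun y => φ (-y)) (Set.Iic x) := fun x =>
    ((integrableOn_Ici_iff_integrableOn_Ioi).2 (hint (-x))).comp_neg_Iic
  have h := (hasDerivAt_integral_Iic (hφ.comp continuous_neg) hint' (-x)).comp x
    (hasDerivAt_neg x)
  have heq : (fun z => ∫ y in Set.Ioi z, φ y)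
      = (fun z => ∫ y in Set.Iic z, (φ ∘ Neg.neg) y) ∘ Neg.neg := by
    ext z
    simp [integral_comp_neg_Iic]
  rw [heq]
  simpa using h

theorem exp_mul_sq_le_integral_Iic {α k : ℝ} (hα : 0 < α) {v v' : ℝ → ℝ}
    (hv : ∀ y, HasDerivAt v (v' y) y) (hlim : Tendsto v atBot (nhds k)) (x : ℝ)
    (hint : IntegrableOn
      (fun y => Real.exp (y / α) * (α ^ 2 / 2 * v' y ^ 2 + v y ^ 2 - k ^ 2)) (Set.Iic x)) :
    α * Real.exp (x / α) * (v x ^ 2 / 2 - k ^ 2) ≤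
      ∫ y in Set.Iic x, Real.exp (y / α) * (α ^ 2 / 2 * v' y ^ 2 + v y ^ 2 - k ^ 2) := by
  set g : ℝ → ℝ := fun y => α * Real.exp (y / α) * (v y ^ 2 / 2 - k ^ 2) with hg
  have hexp : ∀ y : ℝ, HasDerivAt (fun y => Real.exp (y / α)) (Real.exp (y / α) * (1 / α)) y :=
    fun y => ((hasDerivAt_id y).div_const α).exp
  have hgd : ∀ y, HasDerivAt g
      (Real.exp (y / α) * (v y ^ 2 / 2 - k ^ 2 + α * v y * v' y)) y := by
    intro y
    refine (((hexp y).const_mul α).mul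
      ((((hv y).pow 2).div_const 2).sub_const (k ^ 2))).congr_deriv ?_
    simp only [Pi.pow_apply]
    field_simp
    ring
  have hg0 : Tendsto g atBot (nhds 0) := by
    have h1 : Tendsto (fun y : ℝ => Real.exp (y / α)) atBot (nhds 0) :=
      Real.tendsto_exp_atBot.comp (tendsto_id.atBot_div_const hα)
    simpa using (h1.const_mul α).mul (((hlim.pow 2).div_const 2).sub_const (k ^ 2))
  have hL := intervalIntegral_tendsto_integral_Iic x hint tendsto_id
  have hR : Tendsto (fun a => g x - g a) atBot (nhds (g x)) := by
    simpa using hg0.const_sub (g x)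
  refine le_of_tendsto_of_tendsto hR hL ?_
  filter_upwards [eventually_le_atBot x] with a ha
  refine intervalIntegral.sub_le_integral_of_hasDeriv_right_of_le ha
    (fun y _ => (hgd y).continuousAt.continuousWithinAt)
    (fun y _ => (hgd y).hasDerivWithinAt) (hint.mono_set Set.Icc_subset_Iic_self) fun y _ => ?_
  refine mul_le_mul_of_nonneg_left ?_ (Real.exp_pos _).le
  nlinarith [sq_nonneg (α * v' y - v y)]

theorem integral_green_mul {α : ℝ} {w : ℝ → ℝ}
    (hL : ∀ x, IntegrableOn (fun y => Real.exp (y / α) * w y) (Set.Iic x))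
    (hR : ∀ x, IntegrableOn (fun y => Real.exp (-y / α) * w y) (Set.Ioi x)) (x : ℝ) :
    ∫ y, 1 / (2 * α) * Real.exp (-|x - y| / α) * w y =
      1 / (2 * α) * (Real.exp (-x / α) * (∫ y in Set.Iic x, Real.exp (y / α) * w y) +
        Real.exp (x / α) * ∫ y in Set.Ioi x, Real.exp (-y / α) * w y) := by
  have hl : Set.EqOn (fun y => 1 / (2 * α) * Real.exp (-|x - y| / α) * w y)
      (fun y => 1 / (2 * α) * Real.exp (-x / α) * (Real.exp (y / α) * w y)) (Set.Iic x) := by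
    intro y hy
    have : -|x - y| / α = -x / α + y / α := by
      rw [abs_of_nonneg (sub_nonneg.2 hy)]; ring
    simp only [this, Real.exp_add]
    ring
  have hr : Set.EqOn (fun y => 1 / (2 * α) * Real.exp (-|x - y| / α) * w y)
      (fun y => 1 / (2 * α) * Real.exp (x / α) * (Real.exp (-y / α) * w y)) (Set.Ioi x) := by
    intro y hy
    have : -|x - y| / α = x / α + -y / α := by
      rw [abs_of_nonpos (sub_nonpos.2 (le_of_lt hy))]; ring
    simp only [this, Real.exp_add]
    ring
  rw [← intervalIntegral.integral_Iic_add_Ioi (b := x)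
    ((integrableOn_congr_fun hl measurableSet_Iic).2 ((hL x).const_mul _))
    ((integrableOn_congr_fun hr measurableSet_Ioi).2 ((hR x).const_mul _)),
    setIntegral_congr_fun measurableSet_Iic hl, setIntegral_congr_fun measurableSet_Ioi hr,
    integral_const_mul, integral_const_mul]
  ring

/-- The nonlocal term `F = p ∗ ((α²/2) U'² + U² + 2kU)` is twice differentiable, satisfies
`α² F'' = F - ((α²/2) U'² + U² + 2kU)`, and both `F - α F'` and `F + α F'` are bounded below by
`(U + k)² / 2 - k²`. -/
theorem exists_deriv_green_convolution {α k : ℝ} (hα : 0 < α) {U U' F : ℝ → ℝ}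
    (hU : ∀ y, HasDerivAt U (U' y) y) (hU' : Continuous U')
    (hU2 : Integrable fun y => U y ^ 2) (hU'2 : Integrable fun y => U' y ^ 2)
    (htop : Tendsto U atTop (nhds 0)) (hbot : Tendsto U atBot (nhds 0))
    (hF : F = fun z => ∫ y, 1 / (2 * α) * Real.exp (-|z - y| / α) *
      (α ^ 2 / 2 * U' y ^ 2 + U y ^ 2 + 2 * k * U y)) :
    ∃ G : ℝ → ℝ, ∀ x, HasDerivAt F (G x) x ∧
      HasDerivAt G ((F x - (α ^ 2 / 2 * U' x ^ 2 + U x ^ 2 + 2 * k * U x)) / α ^ 2) x ∧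
      (U x + k) ^ 2 / 2 - k ^ 2 ≤ F x - α * G x ∧
      (U x + k) ^ 2 / 2 - k ^ 2 ≤ F x + α * G x := by
  set w : ℝ → ℝ := fun y => α ^ 2 / 2 * U' y ^ 2 + U y ^ 2 + 2 * k * U y with hw
  have hUc : Continuous U := continuous_iff_continuousAt.2 fun y => (hU y).continuousAt
  have hwc : Continuous w := by fun_prop
  have hP : Integrable fun y => α ^ 2 / 2 * U' y ^ 2 + (1 + |k|) * U y ^ 2 :=
    (hU'2.const_mul _).add (hU2.const_mul _)
  have hwP : ∀ y, |w y| ≤ α ^ 2 / 2 * U' y ^ 2 + (1 + |k|) * U y ^ 2 + |k| := by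
    intro y
    have h1 : |2 * k * U y| ≤ |k| * (1 + U y ^ 2) := by
      rw [abs_mul, abs_mul, abs_two]
      rw [← sq_abs (U y)]
      nlinarith [mul_nonneg (abs_nonneg k) (sq_nonneg (|U y| - 1))]
    have h2 : 0 ≤ α ^ 2 / 2 * U' y ^ 2 + U y ^ 2 := by positivity
    calc |w y| ≤ |α ^ 2 / 2 * U' y ^ 2 + U y ^ 2| + |2 * k * U y| := abs_add_le _ _
      _ ≤ _ := by rw [abs_of_nonneg h2]; linarith
  have hLi := integrableOn_exp_div_mul_Iic hα hwc hP hwP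
  have hRi := integrableOn_exp_neg_div_mul_Ioi hα hwc hP hwP
  set L : ℝ → ℝ := fun x => ∫ y in Set.Iic x, Real.exp (y / α) * w y with hLdef
  set R : ℝ → ℝ := fun x => ∫ y in Set.Ioi x, Real.exp (-y / α) * w y with hRdef
  have hLd : ∀ x, HasDerivAt L (Real.exp (x / α) * w x) x :=
    hasDerivAt_integral_Iic (by fun_prop) hLi
  have hRd : ∀ x, HasDerivAt R (-(Real.exp (-x / α) * w x)) x :=
    hasDerivAt_integral_Ioi (by fun_prop) hRi
  have hE : ∀ x : ℝ, HasDerivAt (fun y => Real.exp (y / α)) (Real.exp (x / α) * (1 / α)) x :=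
    fun y => ((hasDerivAt_id y).div_const α).exp
  have hE' : ∀ x : ℝ,
      HasDerivAt (fun y => Real.exp (-y / α)) (Real.exp (-x / α) * (-1 / α)) x :=
    fun y => ((hasDerivAt_neg y).div_const α).exp
  have hEE : ∀ x : ℝ, Real.exp (-x / α) * Real.exp (x / α) = 1 := fun x => by
    rw [← Real.exp_add, neg_div, neg_add_cancel, Real.exp_zero]
  have hF' : F = fun x => 1 / (2 * α) * (Real.exp (-x / α) * L x + Real.exp (x / α) * R x) := by
    rw [hF]
    exact funext (integral_green_mul hLi hRi)
  have hFx := congrFun hF'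
  have hsq : ∀ y, w y = α ^ 2 / 2 * U' y ^ 2 + (U y + k) ^ 2 - k ^ 2 := fun y => by
    simp only [hw]; ring
  refine ⟨fun x => 1 / (2 * α ^ 2) * (-(Real.exp (-x / α) * L x) + Real.exp (x / α) * R x),
    fun x => ⟨?_, ?_, ?_, ?_⟩⟩
  · rw [hF']
    refine ((((hE' x).mul (hLd x)).add ((hE x).mul (hRd x))).const_mul _).congr_deriv ?_
    field_simp
    ring
  · rw [hFx]
    refine (((((hE' x).mul (hLd x)).neg).add ((hE x).mul (hRd x))).const_mul _).congr_deriv ?_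
    have h := hEE x
    change _ = (_ - w x) / _
    generalize Real.exp (-x / α) = a, Real.exp (x / α) = b at h ⊢
    field_simp
    linear_combination (-2 * α * w x) * h
  · have h := exp_mul_sq_le_integral_Iic hα (k := k) (v := fun y => U y + k) (v' := U')
      (fun y => (hU y).add_const k) (by simpa using hbot.add_const k) x
      (by simpa only [hsq] using hLi x)
    have hL' : α * Real.exp (x / α) * ((U x + k) ^ 2 / 2 - k ^ 2) ≤ L x := by
      simpa only [hLdef, hsq] using h
    have h2 := mul_le_mul_of_nonneg_left hL' (Real.exp_pos (-x / α)).le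
    have h3 : F x - α * (1 / (2 * α ^ 2) * (-(Real.exp (-x / α) * L x) + Real.exp (x / α) * R x))
        = Real.exp (-x / α) * L x / α := by
      rw [hFx]; field_simp; ring
    rw [h3, le_div_iff₀ hα]
    linear_combination h2 - α * ((U x + k) ^ 2 / 2 - k ^ 2) * hEE x
  · have hR' : R x = ∫ y in Set.Iic (-x), Real.exp (y / α) * w (-y) := by
      have := integral_comp_neg_Iic (-x) fun y => Real.exp (-y / α) * w y
      simpa using this.symm
    have hRi' : IntegrableOn (fun y => Real.exp (y / α) * w (-y)) (Set.Iic (-x)) := by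
      exact integrableOn_exp_div_mul_Iic hα (hwc.comp continuous_neg) hP.comp_neg
        (fun y => hwP (-y)) (-x)
    have h := exp_mul_sq_le_integral_Iic hα (k := k) (v := fun y => U (-y) + k)
      (v' := fun y => -U' (-y))
      (fun y => by simpa using ((hU (-y)).comp y (hasDerivAt_neg y)).add_const k)
      (by simpa using (htop.comp tendsto_neg_atBot_atTop).add_const k) (-x)
      (by simpa only [hsq, neg_sq] using hRi')
    have hL' : α * Real.exp (-x / α) * ((U x + k) ^ 2 / 2 - k ^ 2) ≤ R x := by
      rw [hR']
      simpa only [hsq, neg_sq, neg_neg] using h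
    have h2 := mul_le_mul_of_nonneg_left hL' (Real.exp_pos (x / α)).le
    have h3 : F x + α * (1 / (2 * α ^ 2) * (-(Real.exp (-x / α) * L x) + Real.exp (x / α) * R x))
        = Real.exp (x / α) * R x / α := by
      rw [hFx]; field_simp; ring
    rw [h3, le_div_iff₀ hα]
    linear_combination h2 - α * ((U x + k) ^ 2 / 2 - k ^ 2) * hEE x

/-- The partial derivatives of a `C²` function of two variables are differentiable, and its space
derivative may be differentiated along a curve with the mixed partials exchanged. -/
theorem ContDiffAt.exists_hasDerivAt_partial_along {u ut ux : ℝ → ℝ → ℝ} {q : ℝ → ℝ} {t c : ℝ}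
    (hu : ContDiffAt ℝ 2 (fun p : ℝ × ℝ => u p.1 p.2) (t, q t))
    (hut : ∀ᶠ p : ℝ × ℝ in nhds (t, q t), HasDerivAt (fun s => u s p.2) (ut p.1 p.2) p.1)
    (hux : ∀ᶠ p : ℝ × ℝ in nhds (t, q t), HasDerivAt (fun y => u p.1 y) (ux p.1 p.2) p.2)
    (hq : HasDerivAt q c t) :
    ∃ utx uxx, HasDerivAt (ut t) utx (q t) ∧ HasDerivAt (ux t) uxx (q t) ∧
      HasDerivAt (fun s => ux s (q s)) (utx + c * uxx) t ∧
      HasDerivAt (fun s => u s (q s)) (ut t (q t) + c * ux t (q t)) t := by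
  set f : ℝ × ℝ → ℝ := fun p => u p.1 p.2 with hf
  have hfd : ∀ᶠ p in nhds (t, q t), HasFDerivAt f (fderiv ℝ f p) p := by
    filter_upwards [hu.eventually (by simp)] with p hp
    exact (hp.differentiableAt (by norm_num)).hasFDerivAt
  have hD : HasFDerivAt (fderiv ℝ f) (fderiv ℝ (fderiv ℝ f) (t, q t)) (t, q t) :=
    ((hu.fderiv_right (m := 1) (by norm_num)).differentiableAt (by norm_num)).hasFDerivAt
  set D := fderiv ℝ (fderiv ℝ f) (t, q t) with hDdef
  have hsymm := second_derivative_symmetric_of_eventually hfd hD (1, 0) (0, 1)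
  have hfst : ∀ p : ℝ × ℝ, HasDerivAt (fun s : ℝ => (s, p.2)) ((1 : ℝ), (0 : ℝ)) p.1 :=
    fun p => (hasDerivAt_id p.1).prodMk (hasDerivAt_const _ _)
  have hsnd : ∀ p : ℝ × ℝ, HasDerivAt (fun y : ℝ => (p.1, y)) ((0 : ℝ), (1 : ℝ)) p.2 :=
    fun p => (hasDerivAt_const _ _).prodMk (hasDerivAt_id p.2)
  have hut' : (fun p : ℝ × ℝ => ut p.1 p.2) =ᶠ[nhds (t, q t)] fun p => fderiv ℝ f p (1, 0) := by
    filter_upwards [hfd, hut] with p hp hp'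
    exact hp'.unique (HasFDerivAt.comp_hasDerivAt (l := f) p.1 hp (hfst p))
  have hux' : (fun p : ℝ × ℝ => ux p.1 p.2) =ᶠ[nhds (t, q t)] fun p => fderiv ℝ f p (0, 1) := by
    filter_upwards [hfd, hux] with p hp hp'
    exact hp'.unique (HasFDerivAt.comp_hasDerivAt (l := f) p.2 hp (hsnd p))
  have hcurve : HasDerivAt (fun s => (s, q s)) ((1 : ℝ), c) t := (hasDerivAt_id t).prodMk hq
  have hutD : HasFDerivAt (fun p : ℝ × ℝ => ut p.1 p.2) (D.flip (1, 0)) (t, q t) :=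
    (hD.clm_apply (hasFDerivAt_const _ _)).congr_of_eventuallyEq hut' |>.congr_fderiv (by
      ext <;> simp)
  have huxD : HasFDerivAt (fun p : ℝ × ℝ => ux p.1 p.2) (D.flip (0, 1)) (t, q t) :=
    (hD.clm_apply (hasFDerivAt_const _ _)).congr_of_eventuallyEq hux' |>.congr_fderiv (by
      ext <;> simp)
  have hsplit : ((1 : ℝ), c) = (1, 0) + c • ((0 : ℝ), (1 : ℝ)) := by simp
  refine ⟨D (0, 1) (1, 0), D (0, 1) (0, 1), ?_, ?_, ?_, ?_⟩
  · exact HasFDerivAt.comp_hasDerivAt (q t) hutD (hsnd (t, q t))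
  · exact HasFDerivAt.comp_hasDerivAt (q t) huxD (hsnd (t, q t))
  · refine (HasFDerivAt.comp_hasDerivAt t huxD hcurve).congr_deriv ?_
    rw [hsplit, map_add, map_smul]
    simp [hsymm]
  · refine (HasFDerivAt.comp_hasDerivAt (l := f) t hfd.self_of_nhds hcurve).congr_deriv ?_
    have h1 := hut'.self_of_nhds
    have h2 := hux'.self_of_nhds
    simp only at h1 h2
    rw [hsplit, map_add, map_smul, h1, h2, smul_eq_mul]

theorem continuousOn_partial_snd {u ux : ℝ → ℝ → ℝ} {I : Set ℝ} (hI : UniqueDiffOn ℝ I)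
    (hu : ContDiffOn ℝ 1 (fun p : ℝ × ℝ => u p.1 p.2) {p | p.1 ∈ I})
    (hux : ∀ t ∈ I, ∀ x, HasDerivAt (fun y => u t y) (ux t x) x) :
    ContinuousOn (fun p : ℝ × ℝ => ux p.1 p.2) {p | p.1 ∈ I} := by
  set f : ℝ × ℝ → ℝ := fun p => u p.1 p.2 with hf
  have hS : UniqueDiffOn ℝ {p : ℝ × ℝ | p.1 ∈ I} := by
    convert hI.prod (uniqueDiffOn_univ (𝕜 := ℝ) (E := ℝ)) using 1
    ext p
    simp
  refine ((hu.continuousOn_fderivWithin hS le_rfl).clm_apply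
    (continuousOn_const (c := ((0 : ℝ), (1 : ℝ))))).congr fun p hp => ?_
  have h := ((hu.differentiableOn (by norm_num)) p hp).hasFDerivWithinAt
  refine (hux p.1 hp p.2).unique (hasDerivWithinAt_univ.1 ?_)
  exact HasFDerivWithinAt.comp_hasDerivWithinAt (l := f) (f := fun y => (p.1, y)) p.2 h
    ((hasDerivAt_const _ _).prodMk (hasDerivAt_id p.2)).hasDerivWithinAt fun _ _ => hp

/-- Lemma 4.2: along the particle trajectories of a solution of the DGH
equation, the quantity
`A(t,x) = e^{q(t,x)/α + (k-λ)t/α}((1/α)(u+k) - uₓ)(t,q(t,x))` is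
nondecreasing in `t` and
`B(t,x) = e^{-q(t,x)/α + (λ-k)t/α}((1/α)(u+k) + uₓ)(t,q(t,x))` is
nonincreasing in `t`. -/
theorem dgh_AB_monotonicity
    (α c₀ γ lam k : ℝ) (hα : 0 < α)
    (hlam : lam = -γ / α ^ 2) (hk : k = (c₀ + γ / α ^ 2) / 2)
    (T : EReal) (hT : (0 : EReal) < T)
    (u ut ux : ℝ → ℝ → ℝ)
    (huC2 : ContDiffOn ℝ 2 (fun p : ℝ × ℝ => u p.1 p.2)
      {p : ℝ × ℝ | 0 ≤ p.1 ∧ (p.1 : EReal) < T})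
    (hut : ∀ t x : ℝ, 0 ≤ t → (t : EReal) < T →
      HasDerivAt (fun s => u s x) (ut t x) t)
    (hux : ∀ t x : ℝ, 0 ≤ t → (t : EReal) < T →
      HasDerivAt (fun y => u t y) (ux t x) x)
    (hL2 : ∀ t : ℝ, 0 ≤ t → (t : EReal) < T →
      Integrable (fun y => (u t y) ^ 2) ∧ Integrable (fun y => (ux t y) ^ 2))
    (hdecay : ∀ t : ℝ, 0 ≤ t → (t : EReal) < T →
      Tendsto (fun y => u t y) atTop (nhds 0) ∧
      Tendsto (fun y => u t y) atBot (nhds 0))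
    -- the DGH equation in nonlocal form, the convolution being in space
    (hPDE : ∀ t x : ℝ, 0 ≤ t → (t : EReal) < T →
      ut t x + (u t x + lam) * ux t x
        = - deriv (fun z => ∫ y : ℝ, (1 / (2 * α)) * Real.exp (-|z - y| / α) *
            ((α ^ 2 / 2) * (ux t y) ^ 2 + (u t y) ^ 2 + 2 * k * u t y)) x)
    (q : ℝ → ℝ → ℝ)
    (hqC1 : ContDiffOn ℝ 1 (fun p : ℝ × ℝ => q p.1 p.2)
      {p : ℝ × ℝ | 0 ≤ p.1 ∧ (p.1 : EReal) < T})
    (hq0 : ∀ x, q 0 x = x)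
    (hqt : ∀ t x : ℝ, 0 ≤ t → (t : EReal) < T →
      HasDerivAt (fun s => q s x) (u t (q t x) + lam) t) :
    ∀ x : ℝ,
      MonotoneOn (fun t =>
          Real.exp (q t x / α + (k - lam) * t / α) *
            ((1 / α) * (u t (q t x) + k) - ux t (q t x)))
        {t : ℝ | 0 ≤ t ∧ (t : EReal) < T} ∧
      AntitoneOn (fun t =>
          Real.exp (-(q t x) / α + (lam - k) * t / α) *
            ((1 / α) * (u t (q t x) + k) + ux t (q t x)))
        {t : ℝ | 0 ≤ t ∧ (t : EReal) < T} := by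
  intro x
  set I : Set ℝ := {t : ℝ | 0 ≤ t ∧ (t : EReal) < T} with hI
  have hIconv : Convex ℝ I := by
    refine Set.OrdConnected.convex ⟨fun a ha b hb c hc => ⟨ha.1.trans hc.1, ?_⟩⟩
    exact (EReal.coe_le_coe_iff.2 hc.2).trans_lt hb.2
  have hopen : IsOpen {t : ℝ | (t : EReal) < T} :=
    isOpen_Iio.preimage continuous_coe_real_ereal
  have hIuniq : UniqueDiffOn ℝ I := by
    obtain ⟨a, ha, haT⟩ := EReal.lt_iff_exists_real_btwn.1 hT
    have ha' : (0 : ℝ) < a := by exact_mod_cast ha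
    refine uniqueDiffOn_convex hIconv ⟨a, ?_⟩
    exact (interior_maximal (s := I) (fun t (ht : 0 < t ∧ (t : EReal) < T) => ⟨ht.1.le, ht.2⟩)
      (isOpen_Ioi.inter hopen)) ⟨ha', haT⟩
  have huxc := continuousOn_partial_snd hIuniq (huC2.of_le (by norm_num))
    fun t ht x => hux t x ht.1 ht.2
  have hqc : ContinuousOn (fun t => q t x) I := fun t ht =>
    (hqt t x ht.1 ht.2).continuousAt.continuousWithinAt
  have hcurve : ContinuousOn (fun t => (t, q t x)) I := continuousOn_id.prodMk hqc
  have hUc : ContinuousOn (fun t => u t (q t x)) I :=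
    huC2.continuousOn.comp hcurve fun t ht => ht
  have hUxc : ContinuousOn (fun t => ux t (q t x)) I := huxc.comp hcurve fun t ht => ht
  have key : ∀ t ∈ interior I, ∃ Fx F : ℝ,
      HasDerivAt (fun s => u s (q s x)) (-Fx) t ∧
      HasDerivAt (fun s => ux s (q s x)) (-(ux t (q t x)) ^ 2 -
        (F - (α ^ 2 / 2 * ux t (q t x) ^ 2 + u t (q t x) ^ 2 + 2 * k * u t (q t x))) / α ^ 2) t ∧
      (u t (q t x) + k) ^ 2 / 2 - k ^ 2 ≤ F - α * Fx ∧
      (u t (q t x) + k) ^ 2 / 2 - k ^ 2 ≤ F + α * Fx := by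
    intro t ht
    obtain ⟨ht0, htT⟩ := interior_subset ht
    have hnear : ∀ᶠ p : ℝ × ℝ in nhds (t, q t x), p.1 ∈ I :=
      continuous_fst.continuousAt (mem_interior_iff_mem_nhds.1 ht)
    obtain ⟨utx, uxx, h1, h2, h3, h4⟩ := ContDiffAt.exists_hasDerivAt_partial_along
      (u := u) (ut := ut) (ux := ux) (q := fun s => q s x) (huC2.contDiffAt hnear)
      (hnear.mono fun p hp => hut p.1 p.2 hp.1 hp.2)
      (hnear.mono fun p hp => hux p.1 p.2 hp.1 hp.2) (hqt t x ht0 htT)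
    obtain ⟨G, hG⟩ := exists_deriv_green_convolution hα (k := k) (U := u t) (U' := ux t)
      (fun y => hux t y ht0 htT)
      (continuousOn_univ.1 (huxc.comp (f := fun y => (t, y)) (by fun_prop)
        fun y _ => ⟨ht0, htT⟩))
      (hL2 t ht0 htT).1 (hL2 t ht0 htT).2 (hdecay t ht0 htT).1 (hdecay t ht0 htT).2 rfl
    obtain ⟨-, hG2, hG3, hG4⟩ := hG (q t x)
    have hpde : ∀ y, ut t y = -G y - (u t y + lam) * ux t y := fun y => by
      have h := hPDE t y ht0 htT
      rw [(hG y).1.deriv] at h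
      linarith
    refine ⟨G (q t x), _, h4.congr_deriv ?_, h3.congr_deriv ?_, hG3, hG4⟩
    · rw [hpde]; ring
    · have h5 := hG2.neg.sub (((hux t (q t x) ht0 htT).add_const lam).mul h2)
      have h6 := h1.unique (h5.congr_of_eventuallyEq (Eventually.of_forall hpde))
      rw [h6]
      ring
  choose! Fx F hu1 hu2 hF1 hF2 using key
  have hlin : ∀ t (c : ℝ), HasDerivAt (fun s : ℝ => c * s / α) (c / α) t := fun t c => by
    simpa using ((hasDerivAt_id t).const_mul c).div_const α
  have hlinc : ∀ c : ℝ, ContinuousOn (fun s : ℝ => c * s / α) I := fun c t _ =>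
    (hlin t c).continuousAt.continuousWithinAt
  constructor
  · refine monotoneOn_of_hasDerivWithinAt_nonneg hIconv
      (((hqc.div_const α).add (hlinc _)).rexp.mul (((hUc.add continuousOn_const).const_mul (1 / α)).sub hUxc))
      (f' := fun t => Real.exp (q t x / α + (k - lam) * t / α) *
        (((u t (q t x) + k) - α * ux t (q t x)) ^ 2 / 2
          + (F t - α * Fx t - ((u t (q t x) + k) ^ 2 / 2 - k ^ 2))) / α ^ 2) ?_ ?_
    · intro t ht
      obtain ⟨ht0, htT⟩ := interior_subset ht
      refine HasDerivAt.hasDerivWithinAt ((((((hqt t x ht0 htT).div_const α).add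
        (hlin t (k - lam))).exp).mul ((((hu1 t ht).add_const k).const_mul (1 / α)).sub
          (hu2 t ht))).congr_deriv ?_)
      simp only [Pi.add_apply, Pi.sub_apply]
      field_simp
      ring
    · intro t ht
      have := sub_nonneg.2 (hF1 t ht)
      positivity
  · refine antitoneOn_of_hasDerivWithinAt_nonpos hIconv
      (((hqc.neg.div_const α).add (hlinc _)).rexp.mul
        (((hUc.add continuousOn_const).const_mul (1 / α)).add hUxc))
      (f' := fun t => -(Real.exp (-(q t x) / α + (lam - k) * t / α) *
        (((u t (q t x) + k) + α * ux t (q t x)) ^ 2 / 2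
          + (F t + α * Fx t - ((u t (q t x) + k) ^ 2 / 2 - k ^ 2))) / α ^ 2)) ?_ ?_
    · intro t ht
      obtain ⟨ht0, htT⟩ := interior_subset ht
      refine HasDerivAt.hasDerivWithinAt ((((((hqt t x ht0 htT).neg.div_const α).add
        (hlin t (lam - k))).exp).mul ((((hu1 t ht).add_const k).const_mul (1 / α)).add
          (hu2 t ht))).congr_deriv ?_)
      simp only [Pi.add_apply, Pi.neg_apply]
      field_simp
      ring
    · intro t ht
      have := sub_nonneg.2 (hF2 t ht)
      rw [neg_nonpos]
      positivity
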